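/- Let A and B be unital R-algebras and M an (A,B)-bimodule, and regard M as a bimodule over the product algebra A×B via (a,b)·m=a·m and m·(a,b)=m·b. Then every derivation of the trivial extension (A×B)⋉M (which is isomorphic to the triangular matrix algebra tri(A;M;B)) is inner if and only if: (1) every derivation d₁: A→A, for which there exist a derivation d₂: B→B and an R-linear map S: M→M with S(a·m)=a·S(m)+d₁(a)·m and S(m·b)=S(m)·b+m·d₂(b) for all a∈A, b∈B, m∈M, is inner; (2) every derivation d₂: B→B, for which there exist a derivation d₁: A→A and such an S, is inner; and (3) every (A×B)-bimodule homomorphism S: M→M is of the form S(m)=a₀·m−m·b₀ for some fixed a₀∈Z(A), b₀∈Z(B). -/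

import Mathlib

open MulOpposite

variable {R A B M : Type*} [CommRing R] [Ring A] [Ring B] [Algebra R A] [Algebra R B]
  [AddCommGroup M] [Module R M] [Module A M] [Module Bᵐᵒᵖ M]
  [SMulCommClass A Bᵐᵒᵖ M] [IsScalarTower R A M] [IsScalarTower R Bᵐᵒᵖ M]

/-- `M` as a left `A × B`-module via `(a,b) • m = a • m`. -/
noncomputable local instance leftInst : Module (A × B) M :=
  Module.compHom M (RingHom.fst A B)

/-- `M` as a right `A × B`-module via `m • (a,b) = m • b`. -/
noncomputable local instance rightInst : Module (A × B)ᵐᵒᵖ M :=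
  Module.compHom M (RingHom.op (RingHom.snd A B))

noncomputable local instance commInst : SMulCommClass (A × B) (A × B)ᵐᵒᵖ M :=
  ⟨fun x y m => smul_comm x.1 (op y.unop.2) m⟩

open TrivSqZeroExt

set_option linter.unusedSectionVars false

@[simp]
theorem prod_smul_def (x : A × B) (m : M) : x • m = x.1 • m := rfl

@[simp]
theorem op_prod_smul_def (x : A × B) (m : M) : op x • m = op x.2 • m := rfl

/-- The diagonal endomorphism `((a, b), m) ↦ ((d₁ a, d₂ b), S m)` of `(A × B) ⋉ M`. -/
def diagonalMap (d₁ : A →ₗ[R] A) (d₂ : B →ₗ[R] B) (S : M →ₗ[R] M) :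
    TrivSqZeroExt (A × B) M →ₗ[R] TrivSqZeroExt (A × B) M where
  toFun X := inl (d₁ X.fst.1, d₂ X.fst.2) + inr (S X.snd)
  map_add' X Y := by ext <;> simp
  map_smul' r X := by ext <;> simp

@[simp]
theorem fst_diagonalMap (d₁ : A →ₗ[R] A) (d₂ : B →ₗ[R] B) (S : M →ₗ[R] M)
    (X : TrivSqZeroExt (A × B) M) :
    (diagonalMap d₁ d₂ S X).fst = (d₁ X.fst.1, d₂ X.fst.2) := by
  simp [diagonalMap]

@[simp]
theorem snd_diagonalMap (d₁ : A →ₗ[R] A) (d₂ : B →ₗ[R] B) (S : M →ₗ[R] M)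
    (X : TrivSqZeroExt (A × B) M) : (diagonalMap d₁ d₂ S X).snd = S X.snd := by
  simp [diagonalMap]

theorem diagonalMap_mul {d₁ : A →ₗ[R] A} {d₂ : B →ₗ[R] B} {S : M →ₗ[R] M}
    (h₁ : ∀ a a' : A, d₁ (a * a') = d₁ a * a' + a * d₁ a')
    (h₂ : ∀ b b' : B, d₂ (b * b') = d₂ b * b' + b * d₂ b')
    (hA : ∀ (a : A) (m : M), S (a • m) = a • S m + d₁ a • m)
    (hB : ∀ (b : B) (m : M), S (op b • m) = op b • S m + op (d₂ b) • m)
    (X Y : TrivSqZeroExt (A × B) M) :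
    diagonalMap d₁ d₂ S (X * Y) = diagonalMap d₁ d₂ S X * Y + X * diagonalMap d₁ d₂ S Y := by
  ext
  · simp [h₁]
  · simp [h₂]
  · simp [hA, hB]
    abel

/-- A derivation of `(A × B) ⋉ M` is the sum of a diagonal derivation and the inner
derivation given by an element of `M`. -/
theorem exists_diagonal_decomposition
    (D : TrivSqZeroExt (A × B) M →ₗ[R] TrivSqZeroExt (A × B) M)
    (hD : ∀ X Y, D (X * Y) = D X * Y + X * D Y) :
    ∃ (d₁ : A →ₗ[R] A) (d₂ : B →ₗ[R] B) (S : M →ₗ[R] M) (m₀ : M),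
      (∀ a a' : A, d₁ (a * a') = d₁ a * a' + a * d₁ a') ∧
      (∀ b b' : B, d₂ (b * b') = d₂ b * b' + b * d₂ b') ∧
      (∀ (a : A) (m : M), S (a • m) = a • S m + d₁ a • m) ∧
      (∀ (b : B) (m : M), S (op b • m) = op b • S m + op (d₂ b) • m) ∧
      ∀ X, D X = diagonalMap d₁ d₂ S X + (X * inr m₀ - inr m₀ * X) := by
  let iA : A →ₗ[R] TrivSqZeroExt (A × B) M :=
    { toFun a := inl (a, 0)
      map_add' a a' := by ext <;> simp
      map_smul' r a := by ext <;> simp }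
  let iB : B →ₗ[R] TrivSqZeroExt (A × B) M :=
    { toFun b := inl (0, b)
      map_add' b b' := by ext <;> simp
      map_smul' r b := by ext <;> simp }
  have fst_iA (a : A) : (iA a).fst = (a, 0) := rfl
  have snd_iA (a : A) : (iA a).snd = 0 := rfl
  have fst_iB (b : B) : (iB b).fst = (0, b) := rfl
  have snd_iB (b : B) : (iB b).snd = 0 := rfl
  let pA : TrivSqZeroExt (A × B) M →ₗ[R] A :=
    { toFun X := X.fst.1
      map_add' X Y := by simp
      map_smul' r X := by simp }
  let pB : TrivSqZeroExt (A × B) M →ₗ[R] B :=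
    { toFun X := X.fst.2
      map_add' X Y := by simp
      map_smul' r X := by simp }
  let pM : TrivSqZeroExt (A × B) M →ₗ[R] M :=
    { toFun X := X.snd
      map_add' X Y := by simp
      map_smul' r X := by simp }
  let iM : M →ₗ[R] TrivSqZeroExt (A × B) M :=
    { toFun m := inr m
      map_add' m n := by ext <;> simp
      map_smul' r m := by ext <;> simp }
  have pA_apply (X) : pA X = X.fst.1 := rfl
  have pB_apply (X) : pB X = X.fst.2 := rfl
  have hAA (a a' : A) : D (iA (a * a')) = D (iA a) * iA a' + iA a * D (iA a') := by
    rw [← hD]; congr 1; ext <;> simp [fst_iA, snd_iA]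
  have hBB (b b' : B) : D (iB (b * b')) = D (iB b) * iB b' + iB b * D (iB b') := by
    rw [← hD]; congr 1; ext <;> simp [fst_iB, snd_iB]
  have hAB (a : A) (b : B) : 0 = D (iA a) * iB b + iA a * D (iB b) := by
    rw [← hD, ← map_zero D]; congr 1; ext <;> simp [fst_iA, snd_iA, fst_iB, snd_iB]
  have hAM (a : A) (m : M) : D (inr (a • m)) = D (iA a) * inr m + iA a * D (inr m) := by
    rw [← hD]; congr 1; ext <;> simp [fst_iA]
  have hMB (b : B) (m : M) :
      D (inr (op b • m)) = D (inr m) * iB b + inr m * D (iB b) := by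
    rw [← hD]; congr 1; ext <;> simp [fst_iB]
  have hA_snd (a : A) : (D (iA a)).fst.2 = 0 := by
    simpa [fst_iA, fst_iB] using (congrArg (fun X => X.fst.2) (hAB a 1)).symm
  have hB_fst (b : B) : (D (iB b)).fst.1 = 0 := by
    simpa [fst_iA, fst_iB] using (congrArg (fun X => X.fst.1) (hAB 1 b)).symm
  have hM_fst (m : M) : (D (inr m)).fst.1 = 0 := by
    simpa [fst_iB] using congrArg (fun X => X.fst.1) (hMB 1 m)
  have hM_snd (m : M) : (D (inr m)).fst.2 = 0 := by
    simpa [fst_iA] using congrArg (fun X => X.fst.2) (hAM 1 m)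
  have hA_M (a : A) : (D (iA a)).snd = a • (D (iA 1)).snd := by
    simpa [fst_iA, snd_iA] using congrArg TrivSqZeroExt.snd (hAA a 1)
  have hB_M (b : B) : (D (iB b)).snd = - (op b • (D (iA 1)).snd) := by
    have h := congrArg TrivSqZeroExt.snd (hAB 1 b)
    simp only [snd_add, snd_mul, snd_zero, fst_iA, snd_iA, fst_iB, snd_iB, prod_smul_def,
      op_prod_smul_def, smul_zero, one_smul, zero_add, add_zero] at h
    exact eq_neg_of_add_eq_zero_right h.symm
  refine ⟨pA ∘ₗ D ∘ₗ iA, pB ∘ₗ D ∘ₗ iB, pM ∘ₗ D ∘ₗ iM, (D (iA 1)).snd, fun a a' => ?_,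
    fun b b' => ?_, fun a m => ?_, fun b m => ?_, fun X => ?_⟩
  · simpa [fst_iA, pA_apply] using congrArg (fun X => X.fst.1) (hAA a a')
  · simpa [fst_iB, pB_apply] using congrArg (fun X => X.fst.2) (hBB b b')
  · have h := congrArg TrivSqZeroExt.snd (hAM a m)
    simp only [snd_add, snd_mul, fst_iA, snd_iA, snd_inr, fst_inr, prod_smul_def,
      op_zero, zero_smul, smul_zero, add_zero] at h
    exact h.trans (add_comm _ _)
  · have h := congrArg TrivSqZeroExt.snd (hMB b m)
    simp only [snd_add, snd_mul, fst_iB, snd_iB, snd_inr, fst_inr, op_prod_smul_def,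
      smul_zero, zero_add, zero_smul] at h
    exact h
  · have hX : X = iA X.fst.1 + iB X.fst.2 + inr X.snd := by
      ext <;> simp [fst_iA, fst_iB, snd_iA, snd_iB]
    have hDX := (congrArg D hX).trans (by rw [map_add, map_add])
    rw [hDX]
    ext
    · simp [hB_fst, hM_fst, pA_apply]
    · simp [hA_snd, hM_snd, pB_apply]
    · simp only [snd_add, snd_sub, snd_mul, snd_diagonalMap, snd_inr, fst_inr, prod_smul_def,
        op_prod_smul_def, hA_M X.fst.1, hB_M X.fst.2]
      simp [pM, iM]
      abel

/-- Every derivation of the triangular matrix algebra `(A × B) ⋉ M ≅ tri(A; M; B)` is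
inner iff: (1) every derivation `d₁` of `A` admitting a compatible pair `(d₂, S)` is
inner; (2) every derivation `d₂` of `B` admitting a compatible pair `(d₁, S)` is inner;
(3) every `(A × B)`-bimodule endomorphism of `M` has the standard form
`S(m) = a₀·m - m·b₀` with `a₀ ∈ Z(A)`, `b₀ ∈ Z(B)`. -/
theorem stmt_19 :
    (∀ D : TrivSqZeroExt (A × B) M →ₗ[R] TrivSqZeroExt (A × B) M,
      (∀ X Y : TrivSqZeroExt (A × B) M, D (X * Y) = D X * Y + X * D Y) →
      ∃ X₀ : TrivSqZeroExt (A × B) M, ∀ X, D X = X₀ * X - X * X₀) ↔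
    ((∀ d₁ : A →ₗ[R] A, (∀ a a' : A, d₁ (a * a') = d₁ a * a' + a * d₁ a') →
        (∃ d₂ : B →ₗ[R] B, (∀ b b' : B, d₂ (b * b') = d₂ b * b' + b * d₂ b') ∧
          ∃ S : M →ₗ[R] M,
            (∀ (a : A) (m : M), S (a • m) = a • S m + d₁ a • m) ∧
            (∀ (b : B) (m : M), S (op b • m) = op b • S m + op (d₂ b) • m)) →
        ∃ a₀ : A, ∀ a : A, d₁ a = a₀ * a - a * a₀) ∧
     (∀ d₂ : B →ₗ[R] B, (∀ b b' : B, d₂ (b * b') = d₂ b * b' + b * d₂ b') →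
        (∃ d₁ : A →ₗ[R] A, (∀ a a' : A, d₁ (a * a') = d₁ a * a' + a * d₁ a') ∧
          ∃ S : M →ₗ[R] M,
            (∀ (a : A) (m : M), S (a • m) = a • S m + d₁ a • m) ∧
            (∀ (b : B) (m : M), S (op b • m) = op b • S m + op (d₂ b) • m)) →
        ∃ b₀ : B, ∀ b : B, d₂ b = b₀ * b - b * b₀) ∧
     (∀ S : M →ₗ[R] M,
        (∀ (x : A × B) (m : M), S (x • m) = x • S m) →
        (∀ (x : A × B) (m : M), S (op x • m) = op x • S m) →
        ∃ (a₀ : A) (b₀ : B), (∀ a : A, a₀ * a = a * a₀) ∧ (∀ b : B, b₀ * b = b * b₀) ∧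
          ∀ m : M, S m = a₀ • m - op b₀ • m)) := by
  constructor
  · intro h
    refine ⟨?_, ?_, ?_⟩
    · rintro d₁ h₁ ⟨d₂, h₂, S, hA, hB⟩
      obtain ⟨X₀, hX₀⟩ := h _ (diagonalMap_mul h₁ h₂ hA hB)
      exact ⟨X₀.fst.1, fun a => by
        simpa using congrArg (fun X => X.fst.1) (hX₀ (inl (a, 0)))⟩
    · rintro d₂ h₂ ⟨d₁, h₁, S, hA, hB⟩
      obtain ⟨X₀, hX₀⟩ := h _ (diagonalMap_mul h₁ h₂ hA hB)
      exact ⟨X₀.fst.2, fun b => by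
        simpa using congrArg (fun X => X.fst.2) (hX₀ (inl (0, b)))⟩
    · intro S hA hB
      obtain ⟨X₀, hX₀⟩ := h _ (diagonalMap_mul (d₁ := (0 : A →ₗ[R] A))
        (d₂ := (0 : B →ₗ[R] B)) (S := S) (by simp) (by simp)
        (fun a m => by simpa using hA (a, 0) m) (fun b m => by simpa using hB (0, b) m))
      refine ⟨X₀.fst.1, X₀.fst.2, fun a => ?_, fun b => ?_, fun m => ?_⟩
      · exact sub_eq_zero.mp (by
          simpa using (congrArg (fun X => X.fst.1) (hX₀ (inl (a, 0)))).symm)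
      · exact sub_eq_zero.mp (by
          simpa using (congrArg (fun X => X.fst.2) (hX₀ (inl (0, b)))).symm)
      · simpa using congrArg TrivSqZeroExt.snd (hX₀ (inr m))
  · rintro ⟨innerA, innerB, central⟩ D hD
    obtain ⟨d₁, d₂, S, m₀, h₁, h₂, hA, hB, hDX⟩ := exists_diagonal_decomposition D hD
    obtain ⟨a₀, ha₀⟩ := innerA d₁ h₁ ⟨d₂, h₂, S, hA, hB⟩
    obtain ⟨b₀, hb₀⟩ := innerB d₂ h₂ ⟨d₁, h₁, S, hA, hB⟩
    have : SMulCommClass R A M := IsScalarTower.to_smulCommClass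
    have : SMulCommClass R Bᵐᵒᵖ M := IsScalarTower.to_smulCommClass
    let L : M →ₗ[R] M :=
      { toFun m := a₀ • m - op b₀ • m
        map_add' m n := by simp only [smul_add]; abel
        map_smul' r m := by
          simp only [RingHom.id_apply, smul_sub, smul_comm r] }
    have hL (m : M) : L m = a₀ • m - op b₀ • m := rfl
    obtain ⟨a₁, b₁, ha₁, hb₁, hS⟩ := central (S - L)
      (fun x m => by
        simp only [prod_smul_def, LinearMap.sub_apply, hL, hA, ha₀, sub_smul, mul_smul,
          smul_sub, smul_comm x.1 (op b₀) m]
        abel)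
      (fun x m => by
        simp only [op_prod_smul_def, LinearMap.sub_apply, hL, hB, hb₀, op_sub, op_mul, sub_smul,
          mul_smul, smul_sub, smul_comm a₀ (op x.2) m]
        abel)
    have hS' (m : M) : S m = (a₁ • m - op b₁ • m) + (a₀ • m - op b₀ • m) := by
      rw [← hS, ← hL, LinearMap.sub_apply, sub_add_cancel]
    refine ⟨inl (a₀ + a₁, b₀ + b₁) - inr m₀, fun X => ?_⟩
    rw [hDX]
    ext
    · simp [ha₀, add_mul, mul_add, ha₁]
    · simp [hb₀, add_mul, mul_add, hb₁]
    · simp [hS', add_smul, smul_neg]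
      abel
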